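/- Let T = q1⁴(q1/5+q2)p1²/(q1−q2) + q2⁴(q1+q2/5)p2²/(q2−q1), K = q1q2(q1²p1−q2²p2)(q1²(q1+3q2)p1 − q2²(3q1+q2)p2)²/(q1−q2)³, and L = (q1²p1−q2²p2)²·(q1⁴(q1³+9q1²q2+21q1q2²+q2³)p1² − 2q1²q2²(q1−q2)(q1²+4q1q2+q2²)p1p2 − q2⁴(q1³+21q1²q2+9q1q2²+q2³)p2²)/(4(q1−q2)³). Then {T,K} = 0, {T,L} = 0, and {L,K} = K² identically on the open set where q1 ≠ q2. -/

import Mathlib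

/-- Canonical Poisson bracket of two functions on phase space (q1,q2,p1,p2). -/
noncomputable def pb (f g : ℝ → ℝ → ℝ → ℝ → ℝ) (q1 q2 p1 p2 : ℝ) : ℝ :=
  (deriv (fun x => f x q2 p1 p2) q1) * (deriv (fun x => g q1 q2 x p2) p1)
  - (deriv (fun x => f q1 q2 x p2) p1) * (deriv (fun x => g x q2 p1 p2) q1)
  + (deriv (fun x => f q1 x p1 p2) q2) * (deriv (fun x => g q1 q2 p1 x) p2)
  - (deriv (fun x => f q1 q2 p1 x) p2) * (deriv (fun x => g q1 x p1 p2) q2)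

noncomputable def T (q1 q2 p1 p2 : ℝ) : ℝ :=
  q1^4 * (q1/5 + q2) * p1^2 / (q1 - q2) + q2^4 * (q1 + q2/5) * p2^2 / (q2 - q1)

noncomputable def K (q1 q2 p1 p2 : ℝ) : ℝ :=
  q1 * q2 * (q1^2*p1 - q2^2*p2)
  * (q1^2*(q1 + 3*q2)*p1 - q2^2*(3*q1 + q2)*p2)^2 / (q1 - q2)^3

noncomputable def L (q1 q2 p1 p2 : ℝ) : ℝ :=
  (q1^2*p1 - q2^2*p2)^2
  * (q1^4*(q1^3 + 9*q1^2*q2 + 21*q1*q2^2 + q2^3)*p1^2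
     - 2*q1^2*q2^2*(q1 - q2)*(q1^2 + 4*q1*q2 + q2^2)*p1*p2
     - q2^4*(q1^3 + 21*q1^2*q2 + 9*q1*q2^2 + q2^3)*p2^2)
  / (4*(q1 - q2)^3)

/-- The quotient rule for `f / (a * g ^ 3)`, with one factor of `g` cancelled. -/
theorem HasDerivAt.div_const_mul_cube {f g : ℝ → ℝ} {f' g' x : ℝ} (a : ℝ)
    (hf : HasDerivAt f f' x) (hg : HasDerivAt g g' x) (ha : a ≠ 0) (h0 : g x ≠ 0) :
    HasDerivAt (fun y => f y / (a * g y ^ 3)) ((f' * g x - 3 * f x * g') / (a * g x ^ 4)) x := by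
  refine (hf.fun_div ((hg.fun_pow 3).const_mul a)
    (mul_ne_zero ha (pow_ne_zero 3 h0))).congr_deriv ?_
  push_cast
  field_simp

theorem deriv_T_q1 (q1 q2 p1 p2 : ℝ) (h : q1 ≠ q2) :
    deriv (fun x => T x q2 p1 p2) q1 =
    (((q1^4 + 4*q1^3*q2)*p1^2 - q2^4*p2^2)*(q1 - q2) - (q1^4*(q1/5 + q2)*p1^2 - q2^4*(q1 +
        q2/5)*p2^2)*1)/(q1 - q2)^2 := by
  have h0 : q1 - q2 ≠ 0 := sub_ne_zero.mpr h
  have hN : HasDerivAt (fun x => (x^4*(x/5 + q2)*p1^2 - q2^4*(x + q2/5)*p2^2))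
      ((q1^4 + 4*q1^3*q2)*p1^2 - q2^4*p2^2) q1 := by
    refine (DifferentiableAt.hasDerivAt (by fun_prop)).congr_deriv ?_
    simp (disch := fun_prop) only [deriv_fun_add, deriv_fun_sub, deriv_fun_mul, deriv_fun_pow,
      deriv_const, deriv_id'', deriv_div_const]
    push_cast
    ring
  have hd : HasDerivAt (fun x : ℝ => (x - q2)) 1 q1 := by
    simpa using (hasDerivAt_id q1).sub_const q2
  have hF : (fun x => T x q2 p1 p2) = fun x => (x^4*(x/5 + q2)*p1^2 - q2^4*(x + q2/5)*p2^2)/(x -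
        q2) := by
    funext x
    rw [T, ← neg_sub x q2, div_neg]
    ring
  rw [hF]
  exact (hN.fun_div hd h0).deriv.trans (by ring)

theorem deriv_K_q1 (q1 q2 p1 p2 : ℝ) (h : q1 ≠ q2) :
    deriv (fun x => K x q2 p1 p2) q1 =
    ((q2*(q1^2*p1 - q2^2*p2)*(q1^2*(q1 + 3*q2)*p1 - q2^2*(3*q1 + q2)*p2)^2 + q1*q2*(2*q1*p1)*
        (q1^2*(q1 + 3*q2)*p1 - q2^2*(3*q1 + q2)*p2)^2 + q1*q2*(q1^2*p1 - q2^2*p2)*(2*(q1^2*(q1 +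
        3*q2)*p1 - q2^2*(3*q1 + q2)*p2)*(((3*q1^2+6*q1*q2)*p1 - 3*q2^2*p2))))*(q1 - q2) -
        3*(q1*q2*(q1^2*p1 - q2^2*p2)*(q1^2*(q1 + 3*q2)*p1 - q2^2*(3*q1 + q2)*p2)^2)*1)/(q1 -
        q2)^4 := by
  have h0 : q1 - q2 ≠ 0 := sub_ne_zero.mpr h
  have hN : HasDerivAt (fun x => (x*q2*(x^2*p1 - q2^2*p2)*(x^2*(x + 3*q2)*p1 - q2^2*(3*x +
        q2)*p2)^2))
      (q2*(q1^2*p1 - q2^2*p2)*(q1^2*(q1 + 3*q2)*p1 - q2^2*(3*q1 + q2)*p2)^2 + q1*q2*(2*q1*p1)*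
        (q1^2*(q1 + 3*q2)*p1 - q2^2*(3*q1 + q2)*p2)^2 + q1*q2*(q1^2*p1 - q2^2*p2)*(2*(q1^2*(q1 +
        3*q2)*p1 - q2^2*(3*q1 + q2)*p2)*(((3*q1^2+6*q1*q2)*p1 - 3*q2^2*p2)))) q1 := by
    refine (DifferentiableAt.hasDerivAt (by fun_prop)).congr_deriv ?_
    simp (disch := fun_prop) only [deriv_fun_add, deriv_fun_sub, deriv_fun_mul, deriv_fun_pow,
      deriv_const, deriv_id'', deriv_const_mul_id]
    push_cast
    ring
  have hd : HasDerivAt (fun x : ℝ => (x - q2)) 1 q1 := by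
    simpa using (hasDerivAt_id q1).sub_const q2
  have hF : (fun x => K x q2 p1 p2) = fun x => (x*q2*(x^2*p1 - q2^2*p2)*(x^2*(x + 3*q2)*p1 -
        q2^2*(3*x + q2)*p2)^2)/(1*(x - q2)^3) := by
    funext x
    rw [K, one_mul]
  rw [hF]
  exact (hN.div_const_mul_cube 1 hd (by norm_num) h0).deriv.trans (by ring)

theorem deriv_L_q1 (q1 q2 p1 p2 : ℝ) (h : q1 ≠ q2) :
    deriv (fun x => L x q2 p1 p2) q1 =
    ((2*(q1^2*p1 - q2^2*p2)*(2*q1*p1)*(q1^4*(q1^3 + 9*q1^2*q2 + 21*q1*q2^2 + q2^3)*p1^2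
     - 2*q1^2*q2^2*(q1 - q2)*(q1^2 + 4*q1*q2 + q2^2)*p1*p2
     - q2^4*(q1^3 + 21*q1^2*q2 + 9*q1*q2^2 + q2^3)*p2^2) + (q1^2*p1 - q2^2*p2)^2*((7*q1^6 +
        54*q1^5*q2 + 105*q1^4*q2^2 + 4*q1^3*q2^3)*p1^2
     - 2*(5*q1^4*q2^2 + 12*q1^3*q2^3 - 9*q1^2*q2^4 - 2*q1*q2^5)*p1*p2
     - q2^4*(3*q1^2 + 42*q1*q2 + 9*q2^2)*p2^2))*(q1 - q2) - 3*((q1^2*p1 -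
        q2^2*p2)^2*(q1^4*(q1^3 + 9*q1^2*q2 + 21*q1*q2^2 + q2^3)*p1^2
     - 2*q1^2*q2^2*(q1 - q2)*(q1^2 + 4*q1*q2 + q2^2)*p1*p2
     - q2^4*(q1^3 + 21*q1^2*q2 + 9*q1*q2^2 + q2^3)*p2^2))*1)/(4*(q1 - q2)^4) := by
  have h0 : q1 - q2 ≠ 0 := sub_ne_zero.mpr h
  have hN : HasDerivAt (fun x => ((x^2*p1 - q2^2*p2)^2*(x^4*(x^3 + 9*x^2*q2 + 21*x*q2^2 + q2^3)*p1^2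
     - 2*x^2*q2^2*(x - q2)*(x^2 + 4*x*q2 + q2^2)*p1*p2
     - q2^4*(x^3 + 21*x^2*q2 + 9*x*q2^2 + q2^3)*p2^2)))
      (2*(q1^2*p1 - q2^2*p2)*(2*q1*p1)*(q1^4*(q1^3 + 9*q1^2*q2 + 21*q1*q2^2 + q2^3)*p1^2
     - 2*q1^2*q2^2*(q1 - q2)*(q1^2 + 4*q1*q2 + q2^2)*p1*p2
     - q2^4*(q1^3 + 21*q1^2*q2 + 9*q1*q2^2 + q2^3)*p2^2) + (q1^2*p1 - q2^2*p2)^2*((7*q1^6 +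
        54*q1^5*q2 + 105*q1^4*q2^2 + 4*q1^3*q2^3)*p1^2
     - 2*(5*q1^4*q2^2 + 12*q1^3*q2^3 - 9*q1^2*q2^4 - 2*q1*q2^5)*p1*p2
     - q2^4*(3*q1^2 + 42*q1*q2 + 9*q2^2)*p2^2)) q1 := by
    refine (DifferentiableAt.hasDerivAt (by fun_prop)).congr_deriv ?_
    simp (disch := fun_prop) only [deriv_fun_add, deriv_fun_sub, deriv_fun_mul, deriv_fun_pow,
      deriv_const, deriv_id'', deriv_const_mul_id]
    push_cast
    ring
  have hd : HasDerivAt (fun x : ℝ => (x - q2)) 1 q1 := by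
    simpa using (hasDerivAt_id q1).sub_const q2
  have hF : (fun x => L x q2 p1 p2) = fun x => ((x^2*p1 - q2^2*p2)^2*(x^4*(x^3 + 9*x^2*q2 +
        21*x*q2^2 + q2^3)*p1^2
     - 2*x^2*q2^2*(x - q2)*(x^2 + 4*x*q2 + q2^2)*p1*p2
     - q2^4*(x^3 + 21*x^2*q2 + 9*x*q2^2 + q2^3)*p2^2))/(4*(x - q2)^3) := by
    funext x
    rw [L]
  rw [hF]
  exact (hN.div_const_mul_cube 4 hd (by norm_num) h0).deriv

theorem deriv_T_q2 (q1 q2 p1 p2 : ℝ) (h : q1 ≠ q2) :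
    deriv (fun x => T q1 x p1 p2) q2 =
    ((q1^4*p1^2 - (4*q1*q2^3 + q2^4)*p2^2)*(q1 - q2) - (q1^4*(q1/5 + q2)*p1^2 - q2^4*(q1 +
        q2/5)*p2^2)*(-1))/(q1 - q2)^2 := by
  have h0 : q1 - q2 ≠ 0 := sub_ne_zero.mpr h
  have hN : HasDerivAt (fun x => (q1^4*(q1/5 + x)*p1^2 - x^4*(q1 + x/5)*p2^2))
      (q1^4*p1^2 - (4*q1*q2^3 + q2^4)*p2^2) q2 := by
    refine (DifferentiableAt.hasDerivAt (by fun_prop)).congr_deriv ?_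
    simp (disch := fun_prop) only [deriv_fun_add, deriv_fun_sub, deriv_fun_mul, deriv_fun_pow,
      deriv_const, deriv_id'', deriv_const_add_id, deriv_div_const]
    push_cast
    ring
  have hd : HasDerivAt (fun x : ℝ => (q1 - x)) (-1) q2 := by
    simpa using (hasDerivAt_id q2).const_sub q1
  have hF : (fun x => T q1 x p1 p2) = fun x => (q1^4*(q1/5 + x)*p1^2 - x^4*(q1 +
        x/5)*p2^2)/(q1 - x) := by
    funext x
    rw [T, ← neg_sub q1 x, div_neg]
    ring
  rw [hF]
  exact (hN.fun_div hd h0).deriv.trans (by ring)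

theorem deriv_K_q2 (q1 q2 p1 p2 : ℝ) (h : q1 ≠ q2) :
    deriv (fun x => K q1 x p1 p2) q2 =
    ((q1*(q1^2*p1 - q2^2*p2)*(q1^2*(q1 + 3*q2)*p1 - q2^2*(3*q1 + q2)*p2)^2 + q1*q2*(-(2*q2*p2))*
        (q1^2*(q1 + 3*q2)*p1 - q2^2*(3*q1 + q2)*p2)^2 + q1*q2*(q1^2*p1 - q2^2*p2)*(2*(q1^2*(q1 +
        3*q2)*p1 - q2^2*(3*q1 + q2)*p2)*((3*q1^2*p1 - (6*q1*q2+3*q2^2)*p2))))*(q1 - q2) -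
        3*(q1*q2*(q1^2*p1 - q2^2*p2)*(q1^2*(q1 + 3*q2)*p1 - q2^2*(3*q1 + q2)*p2)^2)*(-1))/(q1 -
        q2)^4 := by
  have h0 : q1 - q2 ≠ 0 := sub_ne_zero.mpr h
  have hN : HasDerivAt (fun x => (q1*x*(q1^2*p1 - x^2*p2)*(q1^2*(q1 + 3*x)*p1 - x^2*(3*q1 +
        x)*p2)^2))
      (q1*(q1^2*p1 - q2^2*p2)*(q1^2*(q1 + 3*q2)*p1 - q2^2*(3*q1 + q2)*p2)^2 +
        q1*q2*(-(2*q2*p2))*(q1^2*(q1 + 3*q2)*p1 - q2^2*(3*q1 + q2)*p2)^2 + q1*q2*(q1^2*p1 -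
        q2^2*p2)*(2*(q1^2*(q1 + 3*q2)*p1 - q2^2*(3*q1 + q2)*p2)*((3*q1^2*p1 -
        (6*q1*q2+3*q2^2)*p2)))) q2 := by
    refine (DifferentiableAt.hasDerivAt (by fun_prop)).congr_deriv ?_
    simp (disch := fun_prop) only [deriv_fun_add, deriv_fun_sub, deriv_fun_mul, deriv_fun_pow,
      deriv_const, deriv_id'', deriv_const_mul_id, deriv_const_add_id]
    push_cast
    ring
  have hd : HasDerivAt (fun x : ℝ => (q1 - x)) (-1) q2 := by
    simpa using (hasDerivAt_id q2).const_sub q1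
  have hF : (fun x => K q1 x p1 p2) = fun x => (q1*x*(q1^2*p1 - x^2*p2)*(q1^2*(q1 + 3*x)*p1 -
        x^2*(3*q1 + x)*p2)^2)/(1*(q1 - x)^3) := by
    funext x
    rw [K, one_mul]
  rw [hF]
  exact (hN.div_const_mul_cube 1 hd (by norm_num) h0).deriv.trans (by ring)

theorem deriv_L_q2 (q1 q2 p1 p2 : ℝ) (h : q1 ≠ q2) :
    deriv (fun x => L q1 x p1 p2) q2 =
    ((2*(q1^2*p1 - q2^2*p2)*(-(2*q2*p2))*(q1^4*(q1^3 + 9*q1^2*q2 + 21*q1*q2^2 + q2^3)*p1^2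
     - 2*q1^2*q2^2*(q1 - q2)*(q1^2 + 4*q1*q2 + q2^2)*p1*p2
     - q2^4*(q1^3 + 21*q1^2*q2 + 9*q1*q2^2 + q2^3)*p2^2) + (q1^2*p1 - q2^2*p2)^2*(q1^4*(9*q1^2 +
        42*q1*q2 + 3*q2^2)*p1^2
     - 2*(2*q1^5*q2 + 9*q1^4*q2^2 - 12*q1^3*q2^3 - 5*q1^2*q2^4)*p1*p2
     - (4*q1^3*q2^3 + 105*q1^2*q2^4 + 54*q1*q2^5 + 7*q2^6)*p2^2))*(q1 - q2) - 3*((q1^2*p1 -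
        q2^2*p2)^2*(q1^4*(q1^3 + 9*q1^2*q2 + 21*q1*q2^2 + q2^3)*p1^2
     - 2*q1^2*q2^2*(q1 - q2)*(q1^2 + 4*q1*q2 + q2^2)*p1*p2
     - q2^4*(q1^3 + 21*q1^2*q2 + 9*q1*q2^2 + q2^3)*p2^2))*(-1))/(4*(q1 - q2)^4) := by
  have h0 : q1 - q2 ≠ 0 := sub_ne_zero.mpr h
  have hN : HasDerivAt (fun x => ((q1^2*p1 - x^2*p2)^2*(q1^4*(q1^3 + 9*q1^2*x + 21*q1*x^2 +
        x^3)*p1^2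
     - 2*q1^2*x^2*(q1 - x)*(q1^2 + 4*q1*x + x^2)*p1*p2
     - x^4*(q1^3 + 21*q1^2*x + 9*q1*x^2 + x^3)*p2^2)))
      (2*(q1^2*p1 - q2^2*p2)*(-(2*q2*p2))*(q1^4*(q1^3 + 9*q1^2*q2 + 21*q1*q2^2 + q2^3)*p1^2
     - 2*q1^2*q2^2*(q1 - q2)*(q1^2 + 4*q1*q2 + q2^2)*p1*p2
     - q2^4*(q1^3 + 21*q1^2*q2 + 9*q1*q2^2 + q2^3)*p2^2) + (q1^2*p1 - q2^2*p2)^2*(q1^4*(9*q1^2 +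
        42*q1*q2 + 3*q2^2)*p1^2
     - 2*(2*q1^5*q2 + 9*q1^4*q2^2 - 12*q1^3*q2^3 - 5*q1^2*q2^4)*p1*p2
     - (4*q1^3*q2^3 + 105*q1^2*q2^4 + 54*q1*q2^5 + 7*q2^6)*p2^2)) q2 := by
    refine (DifferentiableAt.hasDerivAt (by fun_prop)).congr_deriv ?_
    simp (disch := fun_prop) only [deriv_fun_add, deriv_fun_sub, deriv_fun_mul, deriv_fun_pow,
      deriv_const, deriv_id'', deriv_const_mul_id, deriv_const_sub_id]
    push_cast
    ring
  have hd : HasDerivAt (fun x : ℝ => (q1 - x)) (-1) q2 := by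
    simpa using (hasDerivAt_id q2).const_sub q1
  have hF : (fun x => L q1 x p1 p2) = fun x => ((q1^2*p1 - x^2*p2)^2*(q1^4*(q1^3 + 9*q1^2*x +
        21*q1*x^2 + x^3)*p1^2
     - 2*q1^2*x^2*(q1 - x)*(q1^2 + 4*q1*x + x^2)*p1*p2
     - x^4*(q1^3 + 21*q1^2*x + 9*q1*x^2 + x^3)*p2^2))/(4*(q1 - x)^3) := by
    funext x
    rw [L]
  rw [hF]
  exact (hN.div_const_mul_cube 4 hd (by norm_num) h0).deriv

theorem deriv_T_p1 (q1 q2 p1 p2 : ℝ) (h : q1 ≠ q2) :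
    deriv (fun x => T q1 q2 x p2) p1 =
    (2*q1^4*(q1/5 + q2)*p1)/(q1 - q2) := by
  have h0 : q1 - q2 ≠ 0 := sub_ne_zero.mpr h
  have hN : HasDerivAt (fun x => (q1^4*(q1/5 + q2)*x^2 - q2^4*(q1 + q2/5)*p2^2))
      (2*q1^4*(q1/5 + q2)*p1) p1 := by
    refine (DifferentiableAt.hasDerivAt (by fun_prop)).congr_deriv ?_
    simp (disch := fun_prop) only [deriv_fun_add, deriv_fun_sub, deriv_fun_mul, deriv_fun_pow,
      deriv_const, deriv_id'']
    push_cast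
    ring
  have hF : (fun x => T q1 q2 x p2) = fun x => (q1^4*(q1/5 + q2)*x^2 - q2^4*(q1 +
        q2/5)*p2^2)/(q1 - q2) := by
    funext x
    rw [T, ← neg_sub q1 q2, div_neg]
    ring
  rw [hF]
  exact (hN.div_const (q1 - q2)).deriv.trans (by ring)

theorem deriv_K_p1 (q1 q2 p1 p2 : ℝ) (h : q1 ≠ q2) :
    deriv (fun x => K q1 q2 x p2) p1 =
    (0*(q1^2*p1 - q2^2*p2)*(q1^2*(q1 + 3*q2)*p1 - q2^2*(3*q1 + q2)*p2)^2 + q1*q2*(q1^2)*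
        (q1^2*(q1 + 3*q2)*p1 - q2^2*(3*q1 + q2)*p2)^2 + q1*q2*(q1^2*p1 - q2^2*p2)*(2*(q1^2*(q1 +
        3*q2)*p1 - q2^2*(3*q1 + q2)*p2)*(q1^2*(q1+3*q2))))/(q1 - q2)^3 := by
  have h0 : q1 - q2 ≠ 0 := sub_ne_zero.mpr h
  have hN : HasDerivAt (fun x => (q1*q2*(q1^2*x - q2^2*p2)*(q1^2*(q1 + 3*q2)*x - q2^2*(3*q1 +
        q2)*p2)^2))
      (0*(q1^2*p1 - q2^2*p2)*(q1^2*(q1 + 3*q2)*p1 - q2^2*(3*q1 + q2)*p2)^2 + q1*q2*(q1^2)*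
        (q1^2*(q1 + 3*q2)*p1 - q2^2*(3*q1 + q2)*p2)^2 + q1*q2*(q1^2*p1 - q2^2*p2)*(2*(q1^2*(q1 +
        3*q2)*p1 - q2^2*(3*q1 + q2)*p2)*(q1^2*(q1+3*q2)))) p1 := by
    refine (DifferentiableAt.hasDerivAt (by fun_prop)).congr_deriv ?_
    simp (disch := fun_prop) only [deriv_fun_add, deriv_fun_sub, deriv_fun_mul, deriv_fun_pow,
      deriv_const, deriv_const_mul_id]
    push_cast
    ring
  have hF : (fun x => K q1 q2 x p2) = fun x => (q1*q2*(q1^2*x - q2^2*p2)*(q1^2*(q1 + 3*q2)*x -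
        q2^2*(3*q1 + q2)*p2)^2)/(1*(q1 - q2)^3) := by
    funext x
    rw [K, one_mul]
  rw [hF]
  exact (hN.div_const (1*(q1 - q2)^3)).deriv.trans (by ring)

theorem deriv_L_p1 (q1 q2 p1 p2 : ℝ) (h : q1 ≠ q2) :
    deriv (fun x => L q1 q2 x p2) p1 =
    (2*(q1^2*p1 - q2^2*p2)*(q1^2)*(q1^4*(q1^3 + 9*q1^2*q2 + 21*q1*q2^2 + q2^3)*p1^2
     - 2*q1^2*q2^2*(q1 - q2)*(q1^2 + 4*q1*q2 + q2^2)*p1*p2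
     - q2^4*(q1^3 + 21*q1^2*q2 + 9*q1*q2^2 + q2^3)*p2^2) + (q1^2*p1 - q2^2*p2)^2*(2*q1^4*(q1^3 +
        9*q1^2*q2 + 21*q1*q2^2 + q2^3)*p1
     - 2*q1^2*q2^2*(q1 - q2)*(q1^2 + 4*q1*q2 + q2^2)*p2))/(4*(q1 - q2)^3) := by
  have h0 : q1 - q2 ≠ 0 := sub_ne_zero.mpr h
  have hN : HasDerivAt (fun x => ((q1^2*x - q2^2*p2)^2*(q1^4*(q1^3 + 9*q1^2*q2 + 21*q1*q2^2 +
        q2^3)*x^2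
     - 2*q1^2*q2^2*(q1 - q2)*(q1^2 + 4*q1*q2 + q2^2)*x*p2
     - q2^4*(q1^3 + 21*q1^2*q2 + 9*q1*q2^2 + q2^3)*p2^2)))
      (2*(q1^2*p1 - q2^2*p2)*(q1^2)*(q1^4*(q1^3 + 9*q1^2*q2 + 21*q1*q2^2 + q2^3)*p1^2
     - 2*q1^2*q2^2*(q1 - q2)*(q1^2 + 4*q1*q2 + q2^2)*p1*p2
     - q2^4*(q1^3 + 21*q1^2*q2 + 9*q1*q2^2 + q2^3)*p2^2) + (q1^2*p1 - q2^2*p2)^2*(2*q1^4*(q1^3 +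
        9*q1^2*q2 + 21*q1*q2^2 + q2^3)*p1
     - 2*q1^2*q2^2*(q1 - q2)*(q1^2 + 4*q1*q2 + q2^2)*p2)) p1 := by
    refine (DifferentiableAt.hasDerivAt (by fun_prop)).congr_deriv ?_
    simp (disch := fun_prop) only [deriv_fun_add, deriv_fun_sub, deriv_fun_mul, deriv_fun_pow,
      deriv_const, deriv_id'', deriv_const_mul_id]
    push_cast
    ring
  have hF : (fun x => L q1 q2 x p2) = fun x => ((q1^2*x - q2^2*p2)^2*(q1^4*(q1^3 + 9*q1^2*q2 +
        21*q1*q2^2 + q2^3)*x^2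
     - 2*q1^2*q2^2*(q1 - q2)*(q1^2 + 4*q1*q2 + q2^2)*x*p2
     - q2^4*(q1^3 + 21*q1^2*q2 + 9*q1*q2^2 + q2^3)*p2^2))/(4*(q1 - q2)^3) := by
    funext x
    rw [L]
  rw [hF]
  exact (hN.div_const (4*(q1 - q2)^3)).deriv

theorem deriv_T_p2 (q1 q2 p1 p2 : ℝ) (h : q1 ≠ q2) :
    deriv (fun x => T q1 q2 p1 x) p2 =
    (-2*q2^4*(q1 + q2/5)*p2)/(q1 - q2) := by
  have h0 : q1 - q2 ≠ 0 := sub_ne_zero.mpr h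
  have hN : HasDerivAt (fun x => (q1^4*(q1/5 + q2)*p1^2 - q2^4*(q1 + q2/5)*x^2))
      (-2*q2^4*(q1 + q2/5)*p2) p2 := by
    refine (DifferentiableAt.hasDerivAt (by fun_prop)).congr_deriv ?_
    simp (disch := fun_prop) only [deriv_fun_add, deriv_fun_sub, deriv_fun_mul, deriv_fun_pow,
      deriv_const, deriv_id'']
    push_cast
    ring
  have hF : (fun x => T q1 q2 p1 x) = fun x => (q1^4*(q1/5 + q2)*p1^2 - q2^4*(q1 +
        q2/5)*x^2)/(q1 - q2) := by
    funext x
    rw [T, ← neg_sub q1 q2, div_neg]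
    ring
  rw [hF]
  exact (hN.div_const (q1 - q2)).deriv.trans (by ring)

theorem deriv_K_p2 (q1 q2 p1 p2 : ℝ) (h : q1 ≠ q2) :
    deriv (fun x => K q1 q2 p1 x) p2 =
    (0*(q1^2*p1 - q2^2*p2)*(q1^2*(q1 + 3*q2)*p1 - q2^2*(3*q1 + q2)*p2)^2 + q1*q2*(-q2^2)*
        (q1^2*(q1 + 3*q2)*p1 - q2^2*(3*q1 + q2)*p2)^2 + q1*q2*(q1^2*p1 - q2^2*p2)*(2*(q1^2*(q1 +
        3*q2)*p1 - q2^2*(3*q1 + q2)*p2)*(-(q2^2*(3*q1+q2)))))/(q1 - q2)^3 := by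
  have h0 : q1 - q2 ≠ 0 := sub_ne_zero.mpr h
  have hN : HasDerivAt (fun x => (q1*q2*(q1^2*p1 - q2^2*x)*(q1^2*(q1 + 3*q2)*p1 - q2^2*(3*q1 +
        q2)*x)^2))
      (0*(q1^2*p1 - q2^2*p2)*(q1^2*(q1 + 3*q2)*p1 - q2^2*(3*q1 + q2)*p2)^2 + q1*q2*(-q2^2)*
        (q1^2*(q1 + 3*q2)*p1 - q2^2*(3*q1 + q2)*p2)^2 + q1*q2*(q1^2*p1 - q2^2*p2)*(2*(q1^2*(q1 +
        3*q2)*p1 - q2^2*(3*q1 + q2)*p2)*(-(q2^2*(3*q1+q2))))) p2 := by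
    refine (DifferentiableAt.hasDerivAt (by fun_prop)).congr_deriv ?_
    simp (disch := fun_prop) only [deriv_fun_add, deriv_fun_sub, deriv_fun_mul, deriv_fun_pow,
      deriv_const, deriv_const_mul_id]
    push_cast
    ring
  have hF : (fun x => K q1 q2 p1 x) = fun x => (q1*q2*(q1^2*p1 - q2^2*x)*(q1^2*(q1 + 3*q2)*p1 -
        q2^2*(3*q1 + q2)*x)^2)/(1*(q1 - q2)^3) := by
    funext x
    rw [K, one_mul]
  rw [hF]
  exact (hN.div_const (1*(q1 - q2)^3)).deriv.trans (by ring)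

theorem deriv_L_p2 (q1 q2 p1 p2 : ℝ) (h : q1 ≠ q2) :
    deriv (fun x => L q1 q2 p1 x) p2 =
    (2*(q1^2*p1 - q2^2*p2)*(-q2^2)*(q1^4*(q1^3 + 9*q1^2*q2 + 21*q1*q2^2 + q2^3)*p1^2
     - 2*q1^2*q2^2*(q1 - q2)*(q1^2 + 4*q1*q2 + q2^2)*p1*p2
     - q2^4*(q1^3 + 21*q1^2*q2 + 9*q1*q2^2 + q2^3)*p2^2) + (q1^2*p1 -
        q2^2*p2)^2*(-2*q1^2*q2^2*(q1 - q2)*(q1^2 + 4*q1*q2 + q2^2)*p1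
     - 2*q2^4*(q1^3 + 21*q1^2*q2 + 9*q1*q2^2 + q2^3)*p2))/(4*(q1 - q2)^3) := by
  have h0 : q1 - q2 ≠ 0 := sub_ne_zero.mpr h
  have hN : HasDerivAt (fun x => ((q1^2*p1 - q2^2*x)^2*(q1^4*(q1^3 + 9*q1^2*q2 + 21*q1*q2^2 +
        q2^3)*p1^2
     - 2*q1^2*q2^2*(q1 - q2)*(q1^2 + 4*q1*q2 + q2^2)*p1*x
     - q2^4*(q1^3 + 21*q1^2*q2 + 9*q1*q2^2 + q2^3)*x^2)))
      (2*(q1^2*p1 - q2^2*p2)*(-q2^2)*(q1^4*(q1^3 + 9*q1^2*q2 + 21*q1*q2^2 + q2^3)*p1^2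
     - 2*q1^2*q2^2*(q1 - q2)*(q1^2 + 4*q1*q2 + q2^2)*p1*p2
     - q2^4*(q1^3 + 21*q1^2*q2 + 9*q1*q2^2 + q2^3)*p2^2) + (q1^2*p1 -
        q2^2*p2)^2*(-2*q1^2*q2^2*(q1 - q2)*(q1^2 + 4*q1*q2 + q2^2)*p1
     - 2*q2^4*(q1^3 + 21*q1^2*q2 + 9*q1*q2^2 + q2^3)*p2)) p2 := by
    refine (DifferentiableAt.hasDerivAt (by fun_prop)).congr_deriv ?_
    simp (disch := fun_prop) only [deriv_fun_add, deriv_fun_sub, deriv_fun_mul, deriv_fun_pow,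
      deriv_const, deriv_id'', deriv_const_mul_id]
    push_cast
    ring
  have hF : (fun x => L q1 q2 p1 x) = fun x => ((q1^2*p1 - q2^2*x)^2*(q1^4*(q1^3 + 9*q1^2*q2 +
        21*q1*q2^2 + q2^3)*p1^2
     - 2*q1^2*q2^2*(q1 - q2)*(q1^2 + 4*q1*q2 + q2^2)*p1*x
     - q2^4*(q1^3 + 21*q1^2*q2 + 9*q1*q2^2 + q2^3)*x^2))/(4*(q1 - q2)^3) := by
    funext x
    rw [L]
  rw [hF]
  exact (hN.div_const (4*(q1 - q2)^3)).deriv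

theorem stmt17 (q1 q2 p1 p2 : ℝ) (h : q1 ≠ q2) :
    pb T K q1 q2 p1 p2 = 0 ∧ pb T L q1 q2 p1 p2 = 0 ∧
    pb L K q1 q2 p1 p2 = (K q1 q2 p1 p2)^2 := by
  have h0 : q1 - q2 ≠ 0 := sub_ne_zero.mpr h
  refine ⟨?_, ?_, ?_⟩
  · simp only [pb,
      deriv_T_q1 _ _ _ _ h, deriv_T_q2 _ _ _ _ h, deriv_T_p1 _ _ _ _ h, deriv_T_p2 _ _ _ _ h,
      deriv_K_q1 _ _ _ _ h, deriv_K_q2 _ _ _ _ h, deriv_K_p1 _ _ _ _ h, deriv_K_p2 _ _ _ _ h]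
    field_simp
    ring
  · simp only [pb,
      deriv_T_q1 _ _ _ _ h, deriv_T_q2 _ _ _ _ h, deriv_T_p1 _ _ _ _ h, deriv_T_p2 _ _ _ _ h,
      deriv_L_q1 _ _ _ _ h, deriv_L_q2 _ _ _ _ h, deriv_L_p1 _ _ _ _ h, deriv_L_p2 _ _ _ _ h]
    field_simp
    ring
  · simp only [pb,
      deriv_L_q1 _ _ _ _ h, deriv_L_q2 _ _ _ _ h, deriv_L_p1 _ _ _ _ h, deriv_L_p2 _ _ _ _ h,
      deriv_K_q1 _ _ _ _ h, deriv_K_q2 _ _ _ _ h, deriv_K_p1 _ _ _ _ h, deriv_K_p2 _ _ _ _ h]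
    rw [K]
    field_simp
    ring
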